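/- Fix an alphabet size d ≥ 1. For every ε ∈ (0,1), every δ ∈ (0,1), and every finite set 𝒲 of words over {1,…,d}, there exists b₀ ∈ ℕ such that for all block sizes b ≥ b₀ and all numbers of blocks k ≥ 1 (with N = kb), the block-diagonal random model satisfies P( |(1/N)⟨A_I h₀, A_J h₀⟩ − δ_{I,J}| ≤ ε for all I, J ∈ 𝒲 ) ≥ 1 − δ. -/

import Mathlib

open MeasureTheory ProbabilityTheory Matrix

noncomputable section

/-- Ordered product of the matrices `A i` along the word `I`
(the identity matrix for the empty word). -/
def wordProd {d : ℕ} {n : Type*} [Fintype n] [DecidableEq n]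
    (A : Fin d → Matrix n n ℝ) (I : List (Fin d)) : Matrix n n ℝ :=
  (I.map A).prod

/-- Kronecker delta of two words: `1` if `I = J`, `0` otherwise. -/
def wordDelta {d : ℕ} (I J : List (Fin d)) : ℝ := if I = J then 1 else 0

/-- Sample space of the block-diagonal random model: the entries of the `k` blocks
`B^i_l ∈ ℝ^{b×b}` for each channel `i`, together with the initial vector `h₀ ∈ ℝ^N`
(`N = k⬝b`, an index `(β, l) : Fin b × Fin k` is coordinate `β` of block `l`). -/
abbrev BlockOmega (d k b : ℕ) : Type :=
  (Fin d → Fin k → Fin b → Fin b → ℝ) × ((Fin b × Fin k) → ℝ)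

/-- The probability measure of the block-diagonal random model: all block entries are
i.i.d. centred Gaussians of variance `1/b`, and the entries of `h₀` are i.i.d.
standard Gaussians, independent of the blocks. -/
def blockMeasure (d k b : ℕ) : Measure (BlockOmega d k b) :=
  (Measure.pi fun _ : Fin d => Measure.pi fun _ : Fin k => Measure.pi fun _ : Fin b =>
      Measure.pi fun _ : Fin b => gaussianReal 0 (1 / b)).prod
    (Measure.pi fun _ : Fin b × Fin k => gaussianReal 0 1)

/-- The channel matrices of the block-diagonal model:
`A^i = BlockDiag(B^i_1, …, B^i_k)`. -/
def blockA {d k b : ℕ} (ω : BlockOmega d k b) (i : Fin d) :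
    Matrix (Fin b × Fin k) (Fin b × Fin k) ℝ :=
  Matrix.blockDiagonal fun l => Matrix.of (ω.1 i l)

/-- The random feature `A_I h₀` associated to a word `I`. -/
def blockFeature {d k b : ℕ} (I : List (Fin d)) (ω : BlockOmega d k b) :
    Fin b × Fin k → ℝ :=
  (wordProd (blockA ω) I).mulVec ω.2

/-- Letters of the free monoid generated by the channels and their transposes: `(i, false)` stands
for the matrix of channel `i` and `(i, true)` for its transpose. -/
abbrev Letter (d : ℕ) : Type := Fin d × Bool

/-- The letter representing the transposed matrix. -/
def Letter.adj {d : ℕ} (x : Letter d) : Letter d := (x.1, !x.2)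

/-- The word representing the transpose of the product along a word. -/
def adjWord {d : ℕ} (w : List (Letter d)) : List (Letter d) := (w.map Letter.adj).reverse

/-- The large-size limit of the expected normalised trace of a word, defined by the loop
equation: the first letter is paired with a later transposed copy, which splits the word in two. -/
def limitTrace {d : ℕ} : List (Letter d) → ℝ
  | [] => 1
  | x :: w => ∑ n : Fin w.length,
      if w[n] = x.adj then limitTrace (w.take n) * limitTrace (w.drop (n + 1)) else 0
termination_by w => w.length
decreasing_by all_goals simp

/-- An algebraic model of `d` independent `b × b` matrices with independent centred Gaussian
entries of variance `1 / b` and an independent standard Gaussian vector: the expectation is a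
linear functional satisfying Gaussian integration by parts. -/
structure GaussianEnsemble (d b : ℕ) (R : Type*) [CommRing R] [Algebra ℝ R] where
  /-- The expectation. -/
  expect : R →ₗ[ℝ] ℝ
  /-- The Gaussian matrices. -/
  mat : Fin d → Matrix (Fin b) (Fin b) R
  /-- The Gaussian vector. -/
  vec : Fin b → R
  /-- The partial derivative with respect to a matrix entry. -/
  dmat : Fin d → Fin b → Fin b → Derivation ℝ R R
  /-- The partial derivative with respect to an entry of the vector. -/
  dvec : Fin b → Derivation ℝ R R
  expect_one : expect 1 = 1
  dmat_mat : ∀ i a c j p q, dmat i a c (mat j p q) = if j = i ∧ p = a ∧ q = c then 1 else 0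
  dvec_mat : ∀ a j p q, dvec a (mat j p q) = 0
  dvec_vec : ∀ a p, dvec a (vec p) = if p = a then 1 else 0
  expect_mat_mul : ∀ i a c r, expect (mat i a c * r) = (b : ℝ)⁻¹ * expect (dmat i a c r)
  expect_vec_mul : ∀ a r, expect (vec a * r) = expect (dvec a r)

section MatrixEntries

variable {R n : Type*} [CommRing R] [Fintype n]

theorem sum_sum_mul_eq_trace_mul (A B : Matrix n n R) :
    ∑ a, ∑ c, A c a * B a c = (A * B).trace := by
  simp only [Matrix.trace, Matrix.diag_apply, Matrix.mul_apply]
  exact Finset.sum_comm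

variable [DecidableEq n]

theorem mul_single_mul_apply (U V : Matrix n n R) (a c p q : n) :
    (U * Matrix.single a c (1 : R) * V : Matrix n n R) p q = U p a * V c q := by
  simp [Matrix.mul_apply, Matrix.single_apply, ite_and]

theorem trace_mul_single_mul (U V : Matrix n n R) (a c : n) :
    (U * Matrix.single a c (1 : R) * V).trace = (V * U) c a := by
  simp only [Matrix.trace, Matrix.diag_apply, mul_single_mul_apply]
  rw [Matrix.mul_apply]
  exact Finset.sum_congr rfl fun r _ => by ring

end MatrixEntries

section MatrixDerivation

variable {R n : Type*} [CommRing R] [Algebra ℝ R] [Fintype n]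

theorem map_derivation_mul (D : Derivation ℝ R R) (A B : Matrix n n R) :
    (A * B).map D = A.map D * B + A * B.map D := by
  ext p q
  simp only [Matrix.map_apply, Matrix.mul_apply, Matrix.add_apply, map_sum, Derivation.leibniz,
    smul_eq_mul, ← Finset.sum_add_distrib]
  exact Finset.sum_congr rfl fun r _ => by ring

theorem derivation_trace (D : Derivation ℝ R R) (A : Matrix n n R) :
    D A.trace = (A.map D).trace := by
  simp [Matrix.trace]

theorem derivation_list_prod {α : Type*} (D : Derivation ℝ R R) (f : α → R) (l : List α) :
    D (l.map f).prod = ∑ j : Fin l.length, D (f l[j]) * ((l.eraseIdx j).map f).prod := by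
  induction l with
  | nil => simp
  | cons x l ih =>
    simp only [List.map_cons, List.prod_cons, Derivation.leibniz, smul_eq_mul, ih,
      List.length_cons, Fin.sum_univ_succ, Finset.mul_sum]
    simp
    rw [add_comm, mul_comm]
    congr 1
    exact Finset.sum_congr rfl fun r _ => by ring

end MatrixDerivation

namespace GaussianEnsemble

variable {d b : ℕ} {R : Type*} [CommRing R] [Algebra ℝ R] (G : GaussianEnsemble d b R)

/-- The matrix of a letter. -/
def letterMat (x : Letter d) : Matrix (Fin b) (Fin b) R :=
  if x.2 then (G.mat x.1)ᵀ else G.mat x.1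

/-- The partial derivative with respect to an entry of the matrix of a letter. -/
def dletter (x : Letter d) (a c : Fin b) : Derivation ℝ R R :=
  if x.2 then G.dmat x.1 c a else G.dmat x.1 a c

/-- The product of the matrices along a word. -/
def wordMat (w : List (Letter d)) : Matrix (Fin b) (Fin b) R := (w.map G.letterMat).prod

/-- The normalised trace of the product along a word. -/
def ntrace (w : List (Letter d)) : R := (b : ℝ)⁻¹ • (G.wordMat w).trace

/-- The expectation of a product of normalised traces of words. -/
def traceMoment (ws : List (List (Letter d))) : ℝ := G.expect (ws.map G.ntrace).prod

@[simp] theorem wordMat_nil : G.wordMat [] = 1 := rfl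

theorem wordMat_cons (x : Letter d) (w : List (Letter d)) :
    G.wordMat (x :: w) = G.letterMat x * G.wordMat w := by
  simp [wordMat]

theorem wordMat_append (v w : List (Letter d)) :
    G.wordMat (v ++ w) = G.wordMat v * G.wordMat w := by
  simp [wordMat]

theorem letterMat_adj (x : Letter d) : G.letterMat x.adj = (G.letterMat x)ᵀ := by
  obtain ⟨i, t⟩ := x
  cases t <;> simp [letterMat, Letter.adj]

theorem wordMat_adjWord (w : List (Letter d)) : G.wordMat (adjWord w) = (G.wordMat w)ᵀ := by
  induction w with
  | nil => simp [adjWord]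
  | cons x w ih =>
    have h : adjWord (x :: w) = adjWord w ++ [x.adj] := by simp [adjWord]
    rw [h, wordMat_append, ih, wordMat_cons, wordMat_cons, letterMat_adj]
    simp

theorem expect_letterMat_mul (x : Letter d) (a c : Fin b) (r : R) :
    G.expect (G.letterMat x a c * r) = (b : ℝ)⁻¹ * G.expect (G.dletter x a c r) := by
  obtain ⟨i, t⟩ := x
  cases t <;> simp [letterMat, dletter, G.expect_mat_mul]

theorem map_dletter_letterMat (x y : Letter d) (a c : Fin b) :
    (G.letterMat y).map (G.dletter x a c) =
      (if y = x then Matrix.single a c 1 else 0) +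
        if y = x.adj then Matrix.single c a 1 else 0 := by
  obtain ⟨i, t⟩ := x
  obtain ⟨j, s⟩ := y
  ext p q
  cases t <;> cases s <;>
    simp only [letterMat, dletter, Letter.adj, Matrix.map_apply, Matrix.transpose_apply,
      G.dmat_mat, Prod.mk.injEq, if_true, if_false, Bool.false_eq_true, Bool.not_true,
      Bool.not_false, and_true, and_false, add_zero, zero_add, Bool.true_eq_false] <;>
    by_cases h : j = i <;> simp [h, Matrix.single_apply, eq_comm, and_comm]

theorem map_dletter_wordMat (x : Letter d) (a c : Fin b) (w : List (Letter d)) :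
    (G.wordMat w).map (G.dletter x a c) = ∑ n : Fin w.length,
      ((if w[n] = x then
          G.wordMat (w.take n) * Matrix.single a c 1 * G.wordMat (w.drop (n + 1)) else 0) +
        if w[n] = x.adj then
          G.wordMat (w.take n) * Matrix.single c a 1 * G.wordMat (w.drop (n + 1)) else 0) := by
  induction w with
  | nil =>
    ext p q
    by_cases h : p = q <;> simp [h]
  | cons y w ih =>
    rw [wordMat_cons, map_derivation_mul, ih, map_dletter_letterMat]
    simp only [List.length_cons, Fin.sum_univ_succ, Finset.mul_sum]
    congr 1
    · simp [add_mul, ite_mul]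
    · refine Finset.sum_congr rfl fun n _ => ?_
      simp [mul_add, wordMat_cons, Matrix.mul_assoc, mul_ite]

theorem sum_wordMat_mul_dletter_self (x : Letter d) (w : List (Letter d)) :
    (b : ℝ)⁻¹ • (b : ℝ)⁻¹ • ∑ a, ∑ c, G.dletter x a c (G.wordMat w c a) =
      ∑ n : Fin w.length,
      ((if w[n] = x.adj then G.ntrace (w.take n) * G.ntrace (w.drop (n + 1)) else 0) +
        if w[n] = x then
          (b : ℝ)⁻¹ • G.ntrace (w.take n ++ adjWord (w.drop (n + 1))) else 0) := by
  have h : ∀ a c, G.dletter x a c (G.wordMat w c a) =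
      ((G.wordMat w).map (G.dletter x a c)) c a := fun _ _ => rfl
  simp only [h, map_dletter_wordMat, Matrix.sum_apply, Matrix.add_apply]
  simp only [Finset.sum_comm (s := Finset.univ (α := Fin b)) (t := Finset.univ (α := Fin w.length)),
    Finset.smul_sum (s := Finset.univ (α := Fin w.length))]
  refine Finset.sum_congr rfl fun n _ => ?_
  simp only [Finset.sum_add_distrib, smul_add]
  rw [add_comm]
  congr 1
  · split_ifs
    · simp only [mul_single_mul_apply, ntrace, Matrix.trace, Matrix.diag_apply, smul_mul_smul_comm,
        Finset.sum_mul_sum, smul_smul]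
      congr 1
      rw [Finset.sum_comm]
    · simp
  · split_ifs
    · simp only [mul_single_mul_apply, ntrace, wordMat_append, wordMat_adjWord,
        ← sum_sum_mul_eq_trace_mul, Matrix.transpose_apply]
    · simp

theorem sum_wordMat_mul_dletter_ntrace (x : Letter d) (w u : List (Letter d)) :
    ∑ a, ∑ c, G.wordMat w c a * G.dletter x a c (G.ntrace u) =
      ∑ n : Fin u.length,
      ((if u[n] = x then
          G.ntrace (w ++ adjWord (u.drop (n + 1) ++ u.take n)) else 0) +
        if u[n] = x.adj then
          G.ntrace (w ++ (u.drop (n + 1) ++ u.take n)) else 0) := by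
  simp only [ntrace, Derivation.map_smul, derivation_trace, map_dletter_wordMat, Matrix.trace_sum,
    Matrix.trace_add, Finset.smul_sum, Finset.mul_sum]
  simp only [Finset.sum_comm (s := Finset.univ (α := Fin b)) (t := Finset.univ (α := Fin u.length))]
  refine Finset.sum_congr rfl fun n _ => ?_
  simp only [Finset.sum_add_distrib, smul_add, mul_add]
  congr 1
  · split_ifs
    · rw [wordMat_append, wordMat_adjWord, wordMat_append, ← sum_sum_mul_eq_trace_mul]
      simp only [trace_mul_single_mul, mul_smul_comm, ← Finset.smul_sum, Matrix.transpose_apply]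
    · simp
  · split_ifs
    · rw [wordMat_append, wordMat_append, ← sum_sum_mul_eq_trace_mul]
      simp only [trace_mul_single_mul, mul_smul_comm, ← Finset.smul_sum]
    · simp

/-- The loop equation. -/
theorem traceMoment_cons_cons (x : Letter d) (w : List (Letter d)) (ws : List (List (Letter d))) :
    G.traceMoment ((x :: w) :: ws) =
      (∑ n : Fin w.length,
        ((if w[n] = x.adj then G.traceMoment (w.take n :: w.drop (n + 1) :: ws) else 0) +
          if w[n] = x then
            (b : ℝ)⁻¹ * G.traceMoment ((w.take n ++ adjWord (w.drop (n + 1))) :: ws) else 0)) +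
      ∑ j : Fin ws.length, ∑ n : Fin (ws[j]).length,
        ((if ws[j][n] = x then (b : ℝ)⁻¹ * ((b : ℝ)⁻¹ * G.traceMoment
            ((w ++ adjWord ((ws[j]).drop (n + 1) ++ (ws[j]).take n)) :: ws.eraseIdx j)) else 0) +
          if ws[j][n] = x.adj then (b : ℝ)⁻¹ * ((b : ℝ)⁻¹ * G.traceMoment
            ((w ++ ((ws[j]).drop (n + 1) ++ (ws[j]).take n)) :: ws.eraseIdx j)) else 0) := by
  set Q : R := (ws.map G.ntrace).prod with hQ
  have h1 : G.traceMoment ((x :: w) :: ws) = G.expect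
      (((b : ℝ)⁻¹ • (b : ℝ)⁻¹ • ∑ a, ∑ c, G.dletter x a c (G.wordMat w c a)) * Q) +
      (b : ℝ)⁻¹ * ((b : ℝ)⁻¹ * G.expect (∑ a, ∑ c, G.wordMat w c a * G.dletter x a c Q)) := by
    have h2 : ∀ a c, G.expect (G.letterMat x a c * (G.wordMat w c a * Q)) =
        (b : ℝ)⁻¹ * (G.expect (G.dletter x a c (G.wordMat w c a) * Q) +
          G.expect (G.wordMat w c a * G.dletter x a c Q)) := by
      intro a c
      rw [expect_letterMat_mul, ← map_add]
      congr 2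
      simp only [Derivation.leibniz, smul_eq_mul]
      ring
    have h3 : (G.wordMat (x :: w)).trace * Q =
        ∑ a, ∑ c, G.letterMat x a c * (G.wordMat w c a * Q) := by
      simp only [wordMat_cons, Matrix.trace, Matrix.diag_apply, Matrix.mul_apply, Finset.sum_mul,
        mul_assoc]
    simp only [traceMoment, List.map_cons, List.prod_cons, ← hQ, ntrace, smul_mul_assoc, map_smul,
      h3, map_sum, h2, smul_eq_mul, ← Finset.mul_sum, Finset.sum_add_distrib, Finset.sum_mul]
    ring
  rw [h1, sum_wordMat_mul_dletter_self]
  congr 1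
  · simp only [Finset.sum_mul, map_sum, add_mul, map_add]
    refine Finset.sum_congr rfl fun n _ => ?_
    congr 1 <;> split_ifs <;> simp [traceMoment, hQ, mul_assoc]
  · have h2 : ∑ a, ∑ c, G.wordMat w c a * G.dletter x a c Q =
        ∑ j : Fin ws.length, (∑ a, ∑ c, G.wordMat w c a * G.dletter x a c (G.ntrace ws[j])) *
          ((ws.eraseIdx j).map G.ntrace).prod := by
      simp only [hQ, derivation_list_prod, Finset.mul_sum, Finset.sum_mul]
      simp only [Finset.sum_comm (s := Finset.univ (α := Fin b))
        (t := Finset.univ (α := Fin ws.length)), mul_assoc]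
    rw [h2]
    simp only [sum_wordMat_mul_dletter_ntrace, map_sum, Finset.mul_sum, Finset.sum_mul]
    refine Finset.sum_congr rfl fun j _ => Finset.sum_congr rfl fun n _ => ?_
    simp only [add_mul, map_add, mul_add]
    congr 1 <;> split_ifs <;> simp [traceMoment]

theorem traceMoment_nil_cons (hb : b ≠ 0) (ws : List (List (Letter d))) :
    G.traceMoment ([] :: ws) = G.traceMoment ws := by
  have h : G.ntrace [] = 1 := by
    rw [ntrace, wordMat_nil, Matrix.trace_one, Fintype.card_fin,
      show ((b : ℕ) : R) = (b : ℝ) • (1 : R) by simp [Nat.cast_smul_eq_nsmul], smul_smul,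
      inv_mul_cancel₀ (by exact_mod_cast hb), one_smul]
  simp [traceMoment, h]

end GaussianEnsemble

namespace GaussianEnsemble

theorem tendsto_traceMoment {ι : Type*} {F : Filter ι} {d : ℕ} {b : ι → ℕ} {R : ι → Type*}
    [∀ t, CommRing (R t)] [∀ t, Algebra ℝ (R t)] (G : ∀ t, GaussianEnsemble d (b t) (R t))
    (hb : Filter.Tendsto b F Filter.atTop) (ws : List (List (Letter d))) :
    Filter.Tendsto (fun t => (G t).traceMoment ws) F (nhds (ws.map limitTrace).prod) := by
  have hinv : Filter.Tendsto (fun t => ((b t : ℕ) : ℝ)⁻¹) F (nhds 0) :=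
    tendsto_inv_atTop_zero.comp (tendsto_natCast_atTop_atTop.comp hb)
  induction hN : (ws.map fun w => w.length + 1).sum using Nat.strong_induction_on
    generalizing ws with
  | _ N ih =>
  have ih' : ∀ vs : List (List (Letter d)), (vs.map fun w => w.length + 1).sum < N →
      Filter.Tendsto (fun t => (G t).traceMoment vs) F (nhds (vs.map limitTrace).prod) :=
    fun vs h => ih _ h vs rfl
  match ws, hN with
  | [], _ => simpa [traceMoment, (G _).expect_one] using tendsto_const_nhds
  | [] :: ws, hN =>
    have h := ih' ws (by rw [List.map_cons, List.sum_cons] at hN; simp only [List.length_nil] at hN; omega)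
    simp only [List.map_cons, List.prod_cons, limitTrace, one_mul]
    refine h.congr' ?_
    filter_upwards [hb.eventually_ne_atTop 0] with t ht
    exact ((G t).traceMoment_nil_cons ht ws).symm
  | (x :: w) :: ws, hN =>
    simp only [List.map_cons, List.sum_cons, List.length_cons] at hN
    have hj : ∀ j : Fin ws.length, (ws[j].length + 1) +
        ((ws.eraseIdx j).map fun w => w.length + 1).sum =
          (ws.map fun w => w.length + 1).sum := fun j => by
      simpa only [List.map_cons, List.sum_cons, Fin.getElem_fin] using
        ((List.getElem_cons_eraseIdx_perm j.2).map fun w : List (Letter d) => w.length + 1).sum_eq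
    have hsmall : ∀ vs : List (List (Letter d)), (vs.map fun w => w.length + 1).sum < N →
        Filter.Tendsto (fun t => ((b t : ℕ) : ℝ)⁻¹ * (G t).traceMoment vs) F (nhds 0) :=
      fun vs h => by simpa using hinv.mul (ih' vs h)
    have hsmall2 : ∀ vs : List (List (Letter d)), (vs.map fun w => w.length + 1).sum < N →
        Filter.Tendsto (fun t => ((b t : ℕ) : ℝ)⁻¹ * (((b t : ℕ) : ℝ)⁻¹ * (G t).traceMoment vs)) F
          (nhds 0) :=
      fun vs h => by simpa using hinv.mul (hsmall vs h)
    simp only [traceMoment_cons_cons]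
    have hlim : (((x :: w) :: ws).map limitTrace).prod = (∑ n : Fin w.length,
        ((if w[n] = x.adj then
          ((w.take n :: w.drop (n + 1) :: ws).map limitTrace).prod else 0) + 0)) +
        ∑ j : Fin ws.length, ∑ _n : Fin (ws[j]).length, ((0 : ℝ) + 0) := by
      simp [limitTrace, Finset.sum_mul, mul_assoc]
    rw [hlim]
    refine (tendsto_finsetSum _ fun n _ => .add ?_ ?_).add
      (tendsto_finsetSum _ fun j _ => tendsto_finsetSum _ fun n _ => .add ?_ ?_)
    · split_ifs
      · refine ih' _ ?_
        simp only [List.map_cons, List.sum_cons, List.length_take, List.length_drop]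
        omega
      · exact tendsto_const_nhds
    · split_ifs
      · refine hsmall _ ?_
        simp only [List.map_cons, List.sum_cons, List.length_append, adjWord, List.length_reverse,
          List.length_map, List.length_take, List.length_drop]
        omega
      · exact tendsto_const_nhds
    · split_ifs
      · refine hsmall2 _ ?_
        have := hj j
        simp only [List.map_cons, List.sum_cons, List.length_append, adjWord, List.length_reverse,
          List.length_map, List.length_take, List.length_drop]
        omega
      · exact tendsto_const_nhds
    · split_ifs
      · refine hsmall2 _ ?_
        have := hj j
        simp only [List.map_cons, List.sum_cons, List.length_append, List.length_take,
          List.length_drop]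
        omega
      · exact tendsto_const_nhds

end GaussianEnsemble

/-- The word in untransposed letters given by a list of channels. -/
def channelWord {d : ℕ} (I : List (Fin d)) : List (Letter d) := I.map fun i => (i, false)

theorem limitTrace_channelWord {d : ℕ} {I : List (Fin d)} (hI : I ≠ []) :
    limitTrace (channelWord I) = 0 := by
  cases I with
  | nil => exact absurd rfl hI
  | cons i I =>
    simp [channelWord, limitTrace, Letter.adj]

theorem limitTrace_adjWord_append {d : ℕ} (I J : List (Fin d)) :
    limitTrace (adjWord (channelWord I) ++ channelWord J) = if I = J then 1 else 0 := by
  induction I using List.reverseRecOn generalizing J with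
  | nil =>
    by_cases hJ : J = []
    · simp [hJ, channelWord, adjWord, limitTrace]
    · rw [if_neg (Ne.symm hJ)]
      exact limitTrace_channelWord hJ
  | append_singleton I i ih =>
    have h1 : adjWord (channelWord (I ++ [i])) = (i, true) :: adjWord (channelWord I) := by
      simp [adjWord, channelWord, Letter.adj]
    have hA : ∀ y ∈ adjWord (channelWord I), y.2 = true := by
      simp only [adjWord, channelWord, List.mem_reverse, List.mem_map]
      rintro y ⟨z, ⟨j, -, rfl⟩, rfl⟩
      rfl
    rw [h1, List.cons_append]
    set A := adjWord (channelWord I) with hAdef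
    rw [limitTrace]
    rcases List.eq_nil_or_concat' J with rfl | ⟨J, j, rfl⟩
    · rw [Finset.sum_eq_zero]
      · simp
      · intro n _
        rw [if_neg]
        intro h
        have := hA _ ((List.mem_append.1 (List.getElem_mem n.2)).resolve_right
          (by simp [channelWord]))
        rw [← Fin.getElem_fin] at this
        rw [h] at this
        simp [Letter.adj] at this
    · have hW : A ++ channelWord (J ++ [j]) = (A ++ channelWord J) ++ [(j, false)] := by
        simp [channelWord]
      have hlen : (A ++ channelWord (J ++ [j])).length = (A ++ channelWord J).length + 1 := by
        rw [hW, List.length_append, List.length_singleton]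
      rw [Finset.sum_eq_single ⟨(A ++ channelWord J).length, by omega⟩]
      · have hg : (A ++ channelWord (J ++ [j]))[(A ++ channelWord J).length]'(by omega) =
            (j, false) := by
          simp [hW]
        have ht : (A ++ channelWord (J ++ [j])).take (A ++ channelWord J).length =
            A ++ channelWord J := by
          simp only [hW, List.take_left']
        have hd : (A ++ channelWord (J ++ [j])).drop ((A ++ channelWord J).length + 1) = [] :=
          List.drop_eq_nil_of_le hlen.le
        simp only [Fin.getElem_fin, hg, ht, hd, ih, limitTrace, Letter.adj, mul_one]
        by_cases hij : i = j
        · simp [hij]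
        · simp [hij, Ne.symm hij]
      · intro n _ hn
        have hn' : (n : ℕ) < (A ++ channelWord J).length := by
          have h1 := n.2
          have h2 : (n : ℕ) ≠ (A ++ channelWord J).length := fun h => hn (Fin.ext h)
          omega
        split_ifs with h
        · have hAn : A.length ≤ n := by
            by_contra! hlt
            have h3 := hA A[(n : ℕ)] (List.getElem_mem _)
            rw [Fin.getElem_fin, List.getElem_append_left hlt] at h
            rw [h] at h3
            simp [Letter.adj] at h3
          have hdrop : (A ++ channelWord (J ++ [j])).drop (n + 1) =
              channelWord ((J ++ [j]).drop (n + 1 - A.length)) := by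
            rw [List.drop_append, List.drop_eq_nil_of_le (by omega)]
            simp [channelWord, List.map_drop]
          rw [hdrop, limitTrace_channelWord, mul_zero]
          intro h0
          rw [List.drop_eq_nil_iff] at h0
          simp [channelWord] at hn' h0
          omega
        · rfl
      · simp

namespace GaussianEnsemble

section QuadraticForm

variable {d b : ℕ} {R : Type*} [CommRing R] [Algebra ℝ R] (G : GaussianEnsemble d b R)

/-- The quadratic form of a matrix evaluated at the Gaussian vector. -/
def quad (M : Matrix (Fin b) (Fin b) R) : R := G.vec ⬝ᵥ (M *ᵥ G.vec)

theorem map_dvec_wordMat (a : Fin b) (w : List (Letter d)) :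
    (G.wordMat w).map (G.dvec a) = 0 := by
  induction w with
  | nil =>
    ext p q
    by_cases h : p = q <;> simp [h]
  | cons x w ih =>
    have h : (G.letterMat x).map (G.dvec a) = 0 := by
      obtain ⟨i, t⟩ := x
      ext p q
      cases t <;> simp [letterMat, G.dvec_mat]
    rw [wordMat_cons, map_derivation_mul, ih, h]
    simp

theorem expect_quad_mul {M : Matrix (Fin b) (Fin b) R} (hM : ∀ a, M.map (G.dvec a) = 0) (r : R) :
    G.expect (G.quad M * r) =
      G.expect (M.trace * r) + G.expect (∑ a, (M *ᵥ G.vec) a * G.dvec a r) := by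
  have hM' : ∀ a p q, G.dvec a (M p q) = 0 := fun a p q => congrFun (congrFun (hM a) p) q
  have h : ∀ a, G.dvec a ((M *ᵥ G.vec) a * r) = M a a * r + (M *ᵥ G.vec) a * G.dvec a r := by
    intro a
    simp [Matrix.mulVec, dotProduct, Derivation.leibniz, hM', G.dvec_vec, mul_comm, add_comm]
  rw [quad, dotProduct, Finset.sum_mul]
  simp only [mul_assoc, map_sum, G.expect_vec_mul, h]
  simp only [map_add, Finset.sum_add_distrib, Matrix.trace, Matrix.diag_apply, Finset.sum_mul,
    map_sum]

theorem dvec_quad {M : Matrix (Fin b) (Fin b) R} (hM : ∀ a, M.map (G.dvec a) = 0) (a : Fin b) :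
    G.dvec a (G.quad M) = ((M + Mᵀ) *ᵥ G.vec) a := by
  have hM' : ∀ a p q, G.dvec a (M p q) = 0 := fun a p q => congrFun (congrFun (hM a) p) q
  simp [quad, Matrix.mulVec, dotProduct, Derivation.leibniz, hM', G.dvec_vec, add_mul,
    Finset.sum_add_distrib, mul_comm]
  exact add_comm _ _

theorem expect_quad_wordMat (w : List (Letter d)) :
    G.expect (G.quad (G.wordMat w)) = G.expect (G.wordMat w).trace := by
  simpa using G.expect_quad_mul (fun a => G.map_dvec_wordMat a w) 1

theorem expect_quad_wordMat_sq (w : List (Letter d)) :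
    G.expect (G.quad (G.wordMat w) ^ 2) = G.expect ((G.wordMat w).trace ^ 2) +
      (G.expect (G.wordMat (adjWord w ++ w)).trace +
        G.expect (G.wordMat (adjWord w ++ adjWord w)).trace) := by
  have hw := fun a => G.map_dvec_wordMat a w
  have htr : ∀ a, G.dvec a (G.wordMat w).trace = 0 := fun a => by
    rw [derivation_trace, hw, Matrix.trace_zero]
  have h1 : ∑ a, (G.wordMat w *ᵥ G.vec) a * G.dvec a (G.quad (G.wordMat w)) =
      G.quad (G.wordMat (adjWord w ++ w)) + G.quad (G.wordMat (adjWord w ++ adjWord w)) := by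
    simp only [dvec_quad G hw, wordMat_append, wordMat_adjWord]
    rw [quad, quad, ← dotProduct_add, ← Matrix.add_mulVec, ← Matrix.mul_add, ← Matrix.mulVec_mulVec,
      Matrix.dotProduct_mulVec G.vec, Matrix.vecMul_transpose]
    rfl
  rw [sq, G.expect_quad_mul hw, h1, map_add, expect_quad_wordMat, expect_quad_wordMat, mul_comm,
    G.expect_quad_mul hw]
  simp [htr, sq]

theorem expect_quad_sub_sq (w : List (Letter d)) (c : ℝ) :
    G.expect (((b : ℝ)⁻¹ • G.quad (G.wordMat w) - algebraMap ℝ R c) ^ 2) =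
      G.traceMoment [w, w] + (b : ℝ)⁻¹ * (G.traceMoment [adjWord w ++ w] +
        G.traceMoment [adjWord w ++ adjWord w]) - 2 * c * G.traceMoment [w] + c ^ 2 := by
  have h : ((b : ℝ)⁻¹ • G.quad (G.wordMat w) - algebraMap ℝ R c) ^ 2 =
      ((b : ℝ)⁻¹ ^ 2) • G.quad (G.wordMat w) ^ 2 -
        (2 * c * (b : ℝ)⁻¹) • G.quad (G.wordMat w) + (c ^ 2) • 1 := by
    simp only [Algebra.smul_def, map_mul, map_pow, map_ofNat]
    ring
  rw [h]
  simp only [map_add, map_sub, map_smul, expect_quad_wordMat, expect_quad_wordMat_sq, traceMoment,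
    List.map_cons, List.map_nil, List.prod_cons, List.prod_nil, mul_one, ntrace, smul_pow,
    G.expect_one, smul_eq_mul, ← sq]
  ring

end QuadraticForm

/-- The second moment of the deviation of a normalised inner product of two word features from its
limit vanishes as the matrix size grows. -/
theorem tendsto_expect_quad_sub_sq {ι : Type*} {F : Filter ι} {d : ℕ} {b : ι → ℕ} {R : ι → Type*}
    [∀ t, CommRing (R t)] [∀ t, Algebra ℝ (R t)] (G : ∀ t, GaussianEnsemble d (b t) (R t))
    (hb : Filter.Tendsto b F Filter.atTop) (w : List (Letter d)) :
    Filter.Tendsto (fun t => (G t).expect (((b t : ℝ)⁻¹ • (G t).quad ((G t).wordMat w) -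
      algebraMap ℝ (R t) (limitTrace w)) ^ 2)) F (nhds 0) := by
  have hinv : Filter.Tendsto (fun t => ((b t : ℕ) : ℝ)⁻¹) F (nhds 0) :=
    tendsto_inv_atTop_zero.comp (tendsto_natCast_atTop_atTop.comp hb)
  have hT := tendsto_traceMoment G hb
  simp only [expect_quad_sub_sq]
  convert (((hT [w, w]).add (hinv.mul ((hT [adjWord w ++ w]).add (hT [adjWord w ++ adjWord w])))).sub
    ((hT [w]).const_mul (2 * limitTrace w))).add_const (limitTrace w ^ 2) using 2
  simp
  ring

end GaussianEnsemble

section GaussianMoments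

theorem integrable_pow_gaussianReal (μ : ℝ) (v : NNReal) (n : ℕ) :
    Integrable (fun x => x ^ n) (gaussianReal μ v) := by
  have h := (memLp_id_gaussianReal (μ := μ) (v := v) n).integrable_norm_pow'
  simp only [id_eq] at h
  refine (integrable_norm_iff (by fun_prop)).1 ?_
  simpa using h

theorem integral_pow_succ_gaussianReal {v : NNReal} (hv : v ≠ 0) (n : ℕ) :
    ∫ x, x ^ (n + 1) ∂gaussianReal 0 v = n * v * ∫ x, x ^ (n - 1) ∂gaussianReal 0 v := by
  have hv' : (v : ℝ) ≠ 0 := by exact_mod_cast hv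
  have hint : ∀ m : ℕ, Integrable fun x : ℝ => x ^ m * gaussianPDFReal 0 v x := by
    intro m
    have h := integrable_pow_gaussianReal 0 v m
    rw [gaussianReal_of_var_ne_zero 0 hv, integrable_withDensity_iff_integrable_smul'
      (measurable_gaussianPDF 0 v) (Filter.Eventually.of_forall fun _ => gaussianPDF_lt_top)] at h
    simpa [toReal_gaussianPDF, mul_comm] using h
  have hderiv : ∀ x : ℝ, HasDerivAt (gaussianPDFReal 0 v) (-(x / v) * gaussianPDFReal 0 v x) x := by
    intro x
    rw [gaussianPDFReal_def]
    have h : HasDerivAt (fun x : ℝ => -(x - 0) ^ 2 / (2 * v)) (-(x / v)) x :=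
      (((((hasDerivAt_id x).sub_const 0).fun_pow 2).fun_neg).div_const (2 * (v : ℝ))).congr_deriv
        (by simp only [id_eq, sub_zero]; field_simp; norm_num)
    exact (h.exp.const_mul (Real.sqrt (2 * Real.pi * v))⁻¹).congr_deriv (by ring)
  have hibp := integral_mul_deriv_eq_deriv_mul_of_integrable
    (u := fun x : ℝ => x ^ n) (u' := fun x => n * x ^ (n - 1)) (v := gaussianPDFReal 0 v)
    (v' := fun x => -(x / v) * gaussianPDFReal 0 v x)
    (fun x _ => hasDerivAt_pow n x) (fun x _ => hderiv x)
    (((hint (n + 1)).const_mul (-(v : ℝ)⁻¹)).congr (Filter.Eventually.of_forall fun x => by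
      simp only [Pi.mul_apply]; field_simp; ring))
    (((hint (n - 1)).const_mul (n : ℝ)).congr (Filter.Eventually.of_forall fun x => by
      simp only [Pi.mul_apply]; ring))
    (hint n)
  have h1 : ∫ x : ℝ, x ^ n * (-(x / v) * gaussianPDFReal 0 v x) =
      -(v : ℝ)⁻¹ * ∫ x : ℝ, gaussianPDFReal 0 v x * x ^ (n + 1) := by
    rw [← integral_const_mul]
    congr 1 with x
    field_simp
    ring
  have h2 : ∫ x : ℝ, n * x ^ (n - 1) * gaussianPDFReal 0 v x =
      n * ∫ x : ℝ, gaussianPDFReal 0 v x * x ^ (n - 1) := by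
    rw [← integral_const_mul]
    congr 1 with x
    ring
  rw [h1, h2] at hibp
  simp only [integral_gaussianReal_eq_integral_smul hv, smul_eq_mul]
  field_simp at hibp
  linarith

/-- Gaussian integration by parts for a linear functional whose values on monomials are products of
Gaussian moments. -/
theorem stein_mvPolynomial {σ : Type*} [Fintype σ] (v : σ → NNReal)
    (E : MvPolynomial σ ℝ →ₗ[ℝ] ℝ)
    (hE : ∀ m : σ →₀ ℕ, E (MvPolynomial.monomial m 1) = ∏ s, ∫ x, x ^ m s ∂gaussianReal 0 (v s))
    {s : σ} (hs : v s ≠ 0) (p : MvPolynomial σ ℝ) :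
    E (MvPolynomial.X s * p) = v s * E (MvPolynomial.pderiv s p) := by
  classical
  induction p using MvPolynomial.induction_on' with
  | add p q hp hq => simp only [mul_add, map_add, hp, hq]
  | monomial m c =>
    have hE' : ∀ (m : σ →₀ ℕ) (c : ℝ), E (MvPolynomial.monomial m c) =
        c * ∏ s, ∫ x, x ^ m s ∂gaussianReal 0 (v s) := by
      intro m c
      rw [← hE, ← smul_eq_mul, ← map_smul, MvPolynomial.smul_monomial, smul_eq_mul, mul_one]
    rw [MvPolynomial.pderiv_monomial, MvPolynomial.X, MvPolynomial.monomial_mul, one_mul, hE', hE',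
      ← Finset.mul_prod_erase _ _ (Finset.mem_univ s),
      ← Finset.mul_prod_erase (a := s) (h := Finset.mem_univ s)]
    have h1 : ∀ r ∈ Finset.univ.erase s,
        ∫ x, x ^ (Finsupp.single s 1 + m : σ →₀ ℕ) r ∂gaussianReal 0 (v r) =
          ∫ x, x ^ (m - Finsupp.single s 1 : σ →₀ ℕ) r ∂gaussianReal 0 (v r) := by
      intro r hr
      have : r ≠ s := Finset.ne_of_mem_erase hr
      simp [this.symm]
    rw [Finset.prod_congr rfl h1]
    have h2 := integral_pow_succ_gaussianReal hs (m s)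
    simp only [Finsupp.add_apply, Finsupp.tsub_apply, Finsupp.single_eq_same, add_comm 1 (m s), h2]
    ring

end GaussianMoments

section BlockModel

variable {d k b : ℕ}

/-- The indices of the independent Gaussian variables of the block-diagonal model. -/
abbrev BlockVar (d k b : ℕ) : Type := (Fin d × Fin k × Fin b × Fin b) ⊕ (Fin b × Fin k)

/-- The Gaussian variables of the block-diagonal model. -/
def blockCoord (ω : BlockOmega d k b) : BlockVar d k b → ℝ :=
  Sum.elim (fun s => ω.1 s.1 s.2.1 s.2.2.1 s.2.2.2) ω.2

/-- The variances of the Gaussian variables of the block-diagonal model. -/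
def blockVariance (d k b : ℕ) : BlockVar d k b → NNReal :=
  Sum.elim (fun _ => 1 / b) (fun _ => 1)

instance : IsProbabilityMeasure (blockMeasure d k b) := by
  unfold blockMeasure
  infer_instance

theorem prod_blockCoord (f : BlockVar d k b → ℝ → ℝ) (ω : BlockOmega d k b) :
    ∏ s, f s (blockCoord ω s) =
      (∏ i, ∏ l, ∏ a, ∏ c, f (.inl (i, l, a, c)) (ω.1 i l a c)) * ∏ j, f (.inr j) (ω.2 j) := by
  simp only [Fintype.prod_sum_type, Fintype.prod_prod_type, blockCoord, Sum.elim_inl, Sum.elim_inr]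

theorem integrable_prod_blockCoord (f : BlockVar d k b → ℝ → ℝ)
    (hf : ∀ s, Integrable (f s) (gaussianReal 0 (blockVariance d k b s))) :
    Integrable (fun ω => ∏ s, f s (blockCoord ω s)) (blockMeasure d k b) := by
  simp only [prod_blockCoord]
  exact Integrable.mul_prod
    (Integrable.fintype_prod_dep fun i => Integrable.fintype_prod_dep fun l =>
      Integrable.fintype_prod_dep fun a => Integrable.fintype_prod_dep fun c =>
        hf (.inl (i, l, a, c)))
    (Integrable.fintype_prod_dep fun j => hf (.inr j))

theorem integral_prod_blockCoord (f : BlockVar d k b → ℝ → ℝ) :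
    ∫ ω, ∏ s, f s (blockCoord ω s) ∂blockMeasure d k b =
      ∏ s, ∫ x, f s x ∂gaussianReal 0 (blockVariance d k b s) := by
  simp only [prod_blockCoord, blockMeasure]
  rw [integral_prod_mul (fun x : Fin d → Fin k → Fin b → Fin b → ℝ =>
    ∏ i, ∏ l, ∏ a, ∏ c, f (.inl (i, l, a, c)) (x i l a c))
    (fun y : Fin b × Fin k → ℝ => ∏ j, f (.inr j) (y j)), integral_fintype_prod_eq_prod,
    Fintype.prod_sum_type]
  congr 1
  simp only [Fintype.prod_prod_type]
  refine (integral_fintype_prod_eq_prod (fun i (x : Fin k → Fin b → Fin b → ℝ) =>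
    ∏ l, ∏ a, ∏ c, f (.inl (i, l, a, c)) (x l a c))).trans (Finset.prod_congr rfl fun i _ => ?_)
  refine (integral_fintype_prod_eq_prod (fun l (x : Fin b → Fin b → ℝ) =>
    ∏ a, ∏ c, f (.inl (i, l, a, c)) (x a c))).trans (Finset.prod_congr rfl fun l _ => ?_)
  refine (integral_fintype_prod_eq_prod (fun a (x : Fin b → ℝ) =>
    ∏ c, f (.inl (i, l, a, c)) (x c))).trans (Finset.prod_congr rfl fun a _ => ?_)
  exact integral_fintype_prod_eq_prod fun c => f (.inl (i, l, a, c))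

theorem eval_blockCoord_monomial (m : BlockVar d k b →₀ ℕ) (c : ℝ) (ω : BlockOmega d k b) :
    MvPolynomial.eval (blockCoord ω) (MvPolynomial.monomial m c) =
      c * ∏ s, blockCoord ω s ^ m s := by
  rw [MvPolynomial.eval_monomial, Finsupp.prod_fintype _ _ (by simp)]

theorem integrable_eval_blockCoord (p : MvPolynomial (BlockVar d k b) ℝ) :
    Integrable (fun ω => MvPolynomial.eval (blockCoord ω) p) (blockMeasure d k b) := by
  induction p using MvPolynomial.induction_on' with
  | add p q hp hq =>
    simp only [map_add]
    exact hp.add hq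
  | monomial m c =>
    simp only [eval_blockCoord_monomial]
    exact (integrable_prod_blockCoord (fun s x => x ^ m s)
      fun s => integrable_pow_gaussianReal _ _ _).const_mul c

/-- The expectation of a polynomial in the Gaussian variables of the block-diagonal model. -/
def blockExpect (d k b : ℕ) : MvPolynomial (BlockVar d k b) ℝ →ₗ[ℝ] ℝ where
  toFun p := ∫ ω, MvPolynomial.eval (blockCoord ω) p ∂blockMeasure d k b
  map_add' p q := by
    simp only [map_add]
    exact integral_add (integrable_eval_blockCoord p) (integrable_eval_blockCoord q)
  map_smul' c p := by
    simp only [MvPolynomial.smul_eval, integral_const_mul, RingHom.id_apply, smul_eq_mul]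

theorem blockExpect_apply (p : MvPolynomial (BlockVar d k b) ℝ) :
    blockExpect d k b p = ∫ ω, MvPolynomial.eval (blockCoord ω) p ∂blockMeasure d k b := rfl

theorem blockExpect_X_mul {s : BlockVar d k b} (hs : blockVariance d k b s ≠ 0)
    (p : MvPolynomial (BlockVar d k b) ℝ) :
    blockExpect d k b (MvPolynomial.X s * p) =
      blockVariance d k b s * blockExpect d k b (MvPolynomial.pderiv s p) := by
  refine stein_mvPolynomial (blockVariance d k b) (blockExpect d k b) (fun m => ?_) hs p
  simp only [blockExpect_apply, eval_blockCoord_monomial, one_mul]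
  exact integral_prod_blockCoord fun s x => x ^ m s

/-- The Gaussian ensemble formed by a single block of the block-diagonal model. -/
def blockEnsemble (d k b : ℕ) (l : Fin k) :
    GaussianEnsemble d b (MvPolynomial (BlockVar d k b) ℝ) where
  expect := blockExpect d k b
  mat i := Matrix.of fun a c => MvPolynomial.X (.inl (i, l, a, c))
  vec a := MvPolynomial.X (.inr (a, l))
  dmat i a c := MvPolynomial.pderiv (.inl (i, l, a, c))
  dvec a := MvPolynomial.pderiv (.inr (a, l))
  expect_one := by simp [blockExpect_apply]
  dmat_mat i a c j p q := by
    simp [MvPolynomial.pderiv_X, Pi.single_apply]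
  dvec_mat a j p q := by
    simp [MvPolynomial.pderiv_X]
  dvec_vec a p := by
    simp [MvPolynomial.pderiv_X, Pi.single_apply]
  expect_mat_mul i a c r := by
    have hb : (b : NNReal) ≠ 0 := by
      have := a.pos
      exact_mod_cast this.ne'
    rw [Matrix.of_apply, blockExpect_X_mul (by simpa [blockVariance] using hb)]
    simp [blockVariance]
  expect_vec_mul a r := by
    rw [blockExpect_X_mul (by simp [blockVariance])]
    simp [blockVariance]

end BlockModel

section BlockDecomposition

variable {d k b : ℕ}

theorem wordProd_blockA (ω : BlockOmega d k b) (I : List (Fin d)) :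
    wordProd (blockA ω) I =
      Matrix.blockDiagonal fun l => wordProd (fun i => Matrix.of (ω.1 i l)) I := by
  induction I with
  | nil => simp only [wordProd, List.map_nil, List.prod_nil]; exact Matrix.blockDiagonal_one.symm
  | cons i I ih =>
    simp only [wordProd, List.map_cons, List.prod_cons] at ih ⊢
    rw [ih, blockA, ← Matrix.blockDiagonal_mul]

theorem blockFeature_apply (I : List (Fin d)) (ω : BlockOmega d k b) (a : Fin b) (l : Fin k) :
    blockFeature I ω (a, l) =
      (wordProd (fun i => Matrix.of (ω.1 i l)) I *ᵥ fun c => ω.2 (c, l)) a := by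
  simp [blockFeature, wordProd_blockA, Matrix.mulVec, dotProduct, Fintype.sum_prod_type,
    Matrix.blockDiagonal_apply]

theorem map_eval_wordMat_channelWord (l : Fin k) (I : List (Fin d)) (ω : BlockOmega d k b) :
    ((blockEnsemble d k b l).wordMat (channelWord I)).map (MvPolynomial.eval (blockCoord ω)) =
      wordProd (fun i => Matrix.of (ω.1 i l)) I := by
  rw [← RingHom.mapMatrix_apply, GaussianEnsemble.wordMat, map_list_prod, wordProd, channelWord,
    List.map_map, List.map_map]
  congr 2
  ext i a c
  simp [GaussianEnsemble.letterMat, blockEnsemble, blockCoord]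

theorem eval_quad_wordMat (l : Fin k) (I J : List (Fin d)) (ω : BlockOmega d k b) :
    MvPolynomial.eval (blockCoord ω) ((blockEnsemble d k b l).quad
        ((blockEnsemble d k b l).wordMat (adjWord (channelWord I) ++ channelWord J))) =
      ∑ a, blockFeature I ω (a, l) * blockFeature J ω (a, l) := by
  set G := blockEnsemble d k b l with hG
  have hvec : MvPolynomial.eval (blockCoord ω) ∘ G.vec = fun c => ω.2 (c, l) := by
    ext c
    simp [hG, blockEnsemble, blockCoord]
  have h : G.quad (G.wordMat (adjWord (channelWord I) ++ channelWord J)) =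
      (G.wordMat (channelWord I) *ᵥ G.vec) ⬝ᵥ (G.wordMat (channelWord J) *ᵥ G.vec) := by
    rw [GaussianEnsemble.quad, GaussianEnsemble.wordMat_append, GaussianEnsemble.wordMat_adjWord,
      ← Matrix.mulVec_mulVec, Matrix.dotProduct_mulVec, Matrix.vecMul_transpose]
  rw [h, dotProduct, map_sum]
  refine Finset.sum_congr rfl fun a _ => ?_
  rw [map_mul, RingHom.map_mulVec, RingHom.map_mulVec, hvec, map_eval_wordMat_channelWord,
    map_eval_wordMat_channelWord, blockFeature_apply, blockFeature_apply]

/-- The centred polynomial giving the normalised overlap of two word features in one block. -/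
def blockOverlap (d k b : ℕ) (I J : List (Fin d)) (l : Fin k) :
    MvPolynomial (BlockVar d k b) ℝ :=
  (b : ℝ)⁻¹ • (blockEnsemble d k b l).quad
      ((blockEnsemble d k b l).wordMat (adjWord (channelWord I) ++ channelWord J)) -
    algebraMap ℝ _ (wordDelta I J)

theorem overlap_sub_wordDelta_eq (hk : k ≠ 0) (I J : List (Fin d)) (ω : BlockOmega d k b) :
    ((k * b : ℕ) : ℝ)⁻¹ * (blockFeature I ω ⬝ᵥ blockFeature J ω) - wordDelta I J =
      (k : ℝ)⁻¹ * ∑ l, MvPolynomial.eval (blockCoord ω) (blockOverlap d k b I J l) := by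
  have hk' : (k : ℝ) ≠ 0 := by exact_mod_cast hk
  simp only [blockOverlap, map_sub, MvPolynomial.smul_eval, eval_quad_wordMat,
    MvPolynomial.algebraMap_eq, MvPolynomial.eval_C, Finset.sum_sub_distrib, Finset.sum_const,
    Finset.card_univ, Fintype.card_fin, nsmul_eq_mul, ← Finset.mul_sum, dotProduct,
    Fintype.sum_prod_type_right, Nat.cast_mul, mul_inv]
  field_simp

theorem exists_blockExpect_blockOverlap_sq_le (I J : List (Fin d)) {η : ℝ} (hη : 0 < η) :
    ∃ b₀ : ℕ, ∀ b, b₀ ≤ b → ∀ k (l : Fin k),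
      blockExpect d k b (blockOverlap d k b I J l ^ 2) ≤ η := by
  have h := GaussianEnsemble.tendsto_expect_quad_sub_sq
    (ι := Σ p : ℕ × ℕ, Fin p.1) (F := Filter.comap (fun t => t.1.2) Filter.atTop)
    (b := fun t => t.1.2) (fun t => blockEnsemble d t.1.1 t.1.2 t.2) Filter.tendsto_comap
    (adjWord (channelWord I) ++ channelWord J)
  have h' := h.eventually (ge_mem_nhds hη)
  rw [Filter.eventually_comap] at h'
  obtain ⟨b₀, hb₀⟩ := Filter.eventually_atTop.1 h'
  refine ⟨b₀, fun b hb k l => ?_⟩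
  have := hb₀ b hb ⟨(k, b), l⟩ rfl
  rwa [limitTrace_adjWord_append] at this

theorem integral_overlap_sub_wordDelta_sq_le (hk : k ≠ 0) {I J : List (Fin d)} {η : ℝ}
    (h : ∀ l, blockExpect d k b (blockOverlap d k b I J l ^ 2) ≤ η) :
    ∫ ω, ((k : ℝ)⁻¹ * ∑ l, MvPolynomial.eval (blockCoord ω) (blockOverlap d k b I J l)) ^ 2
      ∂blockMeasure d k b ≤ η := by
  have hk' : (0 : ℝ) < k := by exact_mod_cast Nat.pos_of_ne_zero hk
  calc _ = blockExpect d k b (((k : ℝ)⁻¹ • ∑ l, blockOverlap d k b I J l) ^ 2) := by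
        simp [blockExpect_apply, MvPolynomial.smul_eval]
    _ ≤ blockExpect d k b ((k : ℝ)⁻¹ • ∑ l, blockOverlap d k b I J l ^ 2) := by
        refine integral_mono (integrable_eval_blockCoord _) (integrable_eval_blockCoord _) fun ω => ?_
        simp only [map_pow, MvPolynomial.smul_eval, map_sum]
        have := sq_sum_le_card_mul_sum_sq (s := Finset.univ)
          (f := fun l => MvPolynomial.eval (blockCoord ω) (blockOverlap d k b I J l))
        simp only [Finset.card_univ, Fintype.card_fin] at this
        rw [mul_pow, inv_pow, sq (k : ℝ), mul_inv, mul_assoc]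
        refine mul_le_mul_of_nonneg_left ?_ (by positivity)
        rwa [inv_mul_le_iff₀ hk']
    _ = (k : ℝ)⁻¹ * ∑ l, blockExpect d k b (blockOverlap d k b I J l ^ 2) := by
        rw [map_smul, map_sum, smul_eq_mul]
    _ ≤ (k : ℝ)⁻¹ * ∑ _l : Fin k, η := by
        gcongr
        exact h _
    _ = η := by
        simp [hk'.ne']

theorem blockMeasure_lt_abs_overlap_sub_wordDelta_le (hk : k ≠ 0) {I J : List (Fin d)} {ε η : ℝ}
    (hε : 0 < ε) (h : ∀ l, blockExpect d k b (blockOverlap d k b I J l ^ 2) ≤ ε ^ 2 * η) :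
    blockMeasure d k b {ω | ε < |((k * b : ℕ) : ℝ)⁻¹ * (blockFeature I ω ⬝ᵥ blockFeature J ω)
      - wordDelta I J|} ≤ ENNReal.ofReal η := by
  simp only [overlap_sub_wordDelta_eq hk]
  set f : BlockOmega d k b → ℝ := fun ω =>
    (k : ℝ)⁻¹ * ∑ l, MvPolynomial.eval (blockCoord ω) (blockOverlap d k b I J l) with hf
  have hint : Integrable (fun ω => f ω ^ 2) (blockMeasure d k b) := by
    have := integrable_eval_blockCoord (((k : ℝ)⁻¹ • ∑ l, blockOverlap d k b I J l) ^ 2)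
    simpa [MvPolynomial.smul_eval] using this
  have hmarkov := mul_meas_ge_le_integral_of_nonneg
    (Filter.Eventually.of_forall fun ω => sq_nonneg (f ω)) hint (ε ^ 2)
  have hle : (blockMeasure d k b).real {ω | ε ^ 2 ≤ f ω ^ 2} ≤ η :=
    le_of_mul_le_mul_left (hmarkov.trans (integral_overlap_sub_wordDelta_sq_le hk h))
      (by positivity)
  rw [← ofReal_measureReal]
  refine ENNReal.ofReal_le_ofReal ((measureReal_mono fun ω hω => ?_).trans hle)
  have : ε < |f ω| := hω
  rw [Set.mem_ofPred_eq, ← sq_abs (f ω)]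
  gcongr

end BlockDecomposition

/-- **High-probability almost-orthonormality for the block-diagonal model.**
For every `ε, δ ∈ (0,1)` and every finite set `𝒲` of words over `{1,…,d}` there is a
`b₀` such that for all block sizes `b ≥ b₀` and all numbers of blocks `k ≥ 1`
(with `N = k⬝b`),
`P(|(1/N)⟨A_I h₀, A_J h₀⟩ - δ_{I,J}| ≤ ε for all I, J ∈ 𝒲) ≥ 1 - δ`. -/
theorem blockdiag_high_probability_orthonormality (d : ℕ) (hd : 1 ≤ d)
    (ε δ : ℝ) (hε : ε ∈ Set.Ioo (0 : ℝ) 1) (hδ : δ ∈ Set.Ioo (0 : ℝ) 1)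
    (𝒲 : Finset (List (Fin d))) :
    ∃ b₀ : ℕ, ∀ b : ℕ, b₀ ≤ b → ∀ k : ℕ, 1 ≤ k →
      blockMeasure d k b
          {ω | ∀ I ∈ 𝒲, ∀ J ∈ 𝒲,
            |((k * b : ℕ) : ℝ)⁻¹ * (blockFeature I ω ⬝ᵥ blockFeature J ω)
              - wordDelta I J| ≤ ε}
        ≥ ENNReal.ofReal (1 - δ) := by
  set n := ((𝒲 ×ˢ 𝒲).card : ℝ) with hn
  have hη : 0 < ε ^ 2 * (δ / (n + 1)) :=
    mul_pos (pow_pos hε.1 2) (div_pos hδ.1 (by positivity))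
  choose B hB using fun p : List (Fin d) × List (Fin d) =>
    exists_blockExpect_blockOverlap_sq_le p.1 p.2 hη
  refine ⟨(𝒲 ×ˢ 𝒲).sup B, fun b hb k hk => ?_⟩
  set S : Set (BlockOmega d k b) := {ω | ∀ I ∈ 𝒲, ∀ J ∈ 𝒲,
    |((k * b : ℕ) : ℝ)⁻¹ * (blockFeature I ω ⬝ᵥ blockFeature J ω) - wordDelta I J| ≤ ε} with hS
  have hcompl : Sᶜ ⊆ ⋃ p ∈ 𝒲 ×ˢ 𝒲, {ω | ε < |((k * b : ℕ) : ℝ)⁻¹ *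
      (blockFeature p.1 ω ⬝ᵥ blockFeature p.2 ω) - wordDelta p.1 p.2|} := by
    intro ω hω
    simp only [hS, Set.mem_compl_iff, Set.mem_ofPred_eq, not_forall, not_le] at hω
    obtain ⟨I, hI, J, hJ, h⟩ := hω
    exact Set.mem_biUnion (x := (I, J)) (Finset.mk_mem_product hI hJ) h
  have hbound : blockMeasure d k b Sᶜ ≤ ENNReal.ofReal δ := by
    refine (measure_mono hcompl).trans ((measure_biUnion_finset_le _ _).trans ?_)
    refine (Finset.sum_le_sum fun p hp => blockMeasure_lt_abs_overlap_sub_wordDelta_le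
      (Nat.one_le_iff_ne_zero.1 hk) hε.1
      fun l => hB p b ((Finset.le_sup hp).trans hb) k l).trans ?_
    rw [Finset.sum_const, nsmul_eq_mul, ← ENNReal.ofReal_natCast,
      ← ENNReal.ofReal_mul (Nat.cast_nonneg _)]
    refine ENNReal.ofReal_le_ofReal ?_
    rw [← hn, mul_div_assoc', div_le_iff₀ (by positivity)]
    nlinarith [hδ.1]
  rw [ge_iff_le, ENNReal.ofReal_sub _ hδ.1.le, ENNReal.ofReal_one, tsub_le_iff_right]
  calc (1 : ENNReal) = blockMeasure d k b (S ∪ Sᶜ) := by rw [Set.union_compl_self, measure_univ]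
    _ ≤ blockMeasure d k b S + blockMeasure d k b Sᶜ := measure_union_le _ _
    _ ≤ blockMeasure d k b S + ENNReal.ofReal δ := by gcongr

end
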